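/- Let S = ∑_{n=0}^∞ a_n be a conditionally divergent series of real numbers with a_0 ≤ 0, such that a_n > 0 for infinitely many n and a_n ≤ 0 for infinitely many n. Then the set Z_R = { r ∈ ℝ : ∑_{n=0}^∞ a_{σ(n)} = r for some type R λ-permutation σ of S } is either empty, a singleton, or all of ℝ. -/

import Mathlib

open Filter Finset

noncomputable section
open scoped Classical

/-- Partial sum of the series `∑ a n`: sum of the first `n` terms. -/
def partialSum (a : ℕ → ℝ) (n : ℕ) : ℝ := ∑ i ∈ Finset.range n, a i

/-- The series `∑ a n` converges to `L`. -/
def ConvergesTo (a : ℕ → ℝ) (L : ℝ) : Prop :=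
  Filter.Tendsto (partialSum a) Filter.atTop (nhds L)

/-- The series `∑ a n` converges. -/
def Converges (a : ℕ → ℝ) : Prop := ∃ L : ℝ, ConvergesTo a L

/-- The series `∑ a n` is conditionally divergent: it diverges, but some
rearrangement of it converges. -/
def CondDivergent (a : ℕ → ℝ) : Prop :=
  ¬ Converges a ∧ ∃ σ : Equiv.Perm ℕ, Converges (fun n => a (σ n))

/-- `σ` is a type R permutation of the series `∑ a n`: it preserves the relative
order of terms of the same sign. -/
def IsTypeR (a : ℕ → ℝ) (σ : Equiv.Perm ℕ) : Prop :=
  ∀ i j : ℕ, σ i < σ j →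
    ((0 < a (σ i) ∧ 0 < a (σ j)) ∨ (a (σ i) ≤ 0 ∧ a (σ j) ≤ 0)) → i < j

/-- The number of maximal integer intervals whose union is the finite set `s`
(= the number of `x ∈ s` with `x + 1 ∉ s`). -/
def blockCount (s : Finset ℕ) : ℕ := (s.filter (fun x => x + 1 ∉ s)).card

/-- `σ` has bounded block number `C`: at every stage `n`, the set
`σ '' {0, 1, …, n}` is a union of at most `C` maximal integer intervals. -/
def HasBBN (σ : Equiv.Perm ℕ) (C : ℕ) : Prop :=
  ∀ n : ℕ, blockCount ((Finset.range (n + 1)).image σ) ≤ C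

/-- `σ` is a type R λ-permutation of the series `∑ a n`: a type R permutation
with bounded block number whose rearranged series converges. -/
def IsTypeRLambda (a : ℕ → ℝ) (σ : Equiv.Perm ℕ) : Prop :=
  IsTypeR a σ ∧ (∃ C : ℕ, HasBBN σ C) ∧ Converges (fun n => a (σ n))

/-- The set of sums attainable by type R λ-permutations of `∑ a n`. -/
def ZR (a : ℕ → ℝ) : Set ℝ :=
  {r : ℝ | ∃ σ : Equiv.Perm ℕ, IsTypeRLambda a σ ∧ ConvergesTo (fun n => a (σ n)) r}

/-- The first element `p_i` of the `i`-th positive block `P_i` (blocks 1-indexed):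
the `i`-th index `n` with `a n > 0` which starts a maximal interval of positive terms. -/
def posStartIdx (a : ℕ → ℝ) (i : ℕ) : ℕ :=
  Nat.nth (fun n => 0 < a n ∧ (n = 0 ∨ a (n - 1) ≤ 0)) (i - 1)

/-- The last element `q_i` of the `i`-th positive block `P_i` (blocks 1-indexed). -/
def posEndIdx (a : ℕ → ℝ) (i : ℕ) : ℕ :=
  Nat.nth (fun n => 0 < a n ∧ a (n + 1) ≤ 0) (i - 1)

/-- The first element `n_i` of the `i`-th negative block `N_i` (blocks 1-indexed). -/
def negStartIdx (a : ℕ → ℝ) (i : ℕ) : ℕ :=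
  Nat.nth (fun n => a n ≤ 0 ∧ (n = 0 ∨ 0 < a (n - 1))) (i - 1)

/-- The last element `m_i` of the `i`-th negative block `N_i` (blocks 1-indexed). -/
def negEndIdx (a : ℕ → ℝ) (i : ℕ) : ℕ :=
  Nat.nth (fun n => a n ≤ 0 ∧ 0 < a (n + 1)) (i - 1)

/-- `S_{[P_i, P_j]}`: the sum of the terms of `∑ a n` lying in the positive blocks
`P_i ∪ ⋯ ∪ P_j` (interpreted as `0` when `j < i`). -/
def SP (a : ℕ → ℝ) (i j : ℕ) : ℝ :=
  if j < i then 0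
  else ∑ n ∈ Finset.Icc (posStartIdx a i) (posEndIdx a j), if 0 < a n then a n else 0

/-- `S_{[N_i, N_j]}`: the sum of the terms of `∑ a n` lying in the negative blocks
`N_i ∪ ⋯ ∪ N_j` (interpreted as `0` when `j < i`). -/
def SN (a : ℕ → ℝ) (i j : ℕ) : ℝ :=
  if j < i then 0
  else ∑ n ∈ Finset.Icc (negStartIdx a i) (negEndIdx a j), if a n ≤ 0 then a n else 0

/-- The substantial property on positive blocks. -/
def STP (a : ℕ → ℝ) : Prop :=
  ∃ k : ℕ, ∃ ε : ℝ, 0 < ε ∧ ∃ i0 : ℕ, ∀ i > i0, SP a i (i + k) ≥ ε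

/-- The substantial property on negative blocks. -/
def STN (a : ℕ → ℝ) : Prop :=
  ∃ k : ℕ, ∃ ε : ℝ, 0 < ε ∧ ∃ i0 : ℕ, ∀ i > i0, SN a i (i + k) ≤ -ε

/-- The finite set of the positions `< u` of positive terms and the positions `< v` of
nonpositive terms. -/
def cutSet (a : ℕ → ℝ) (u v : ℕ) : Finset ℕ :=
  (range u).filter (fun i => 0 < a i) ∪ (range v).filter (fun i => a i ≤ 0)

/-- The sum of the positive terms at positions `< u`. -/
def posSum (a : ℕ → ℝ) (u : ℕ) : ℝ := ∑ i ∈ range u, max (a i) 0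

/-- The sum of the absolute values of the nonpositive terms at positions `< v`. -/
def negSum (a : ℕ → ℝ) (v : ℕ) : ℝ := ∑ i ∈ range v, max (-a i) 0

/-- The number of changes from nonpositive to positive terms at positions `< n`. -/
def ascents (a : ℕ → ℝ) (n : ℕ) : ℕ := Nat.count (fun i => a i ≤ 0 ∧ 0 < a (i + 1)) n

/-- The number of changes from positive to nonpositive terms at positions `< n`. -/
def descents (a : ℕ → ℝ) (n : ℕ) : ℕ := Nat.count (fun i => 0 < a i ∧ a (i + 1) ≤ 0) n

lemma mem_cutSet {a : ℕ → ℝ} {u v i : ℕ} :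
    i ∈ cutSet a u v ↔ (i < u ∧ 0 < a i) ∨ (i < v ∧ a i ≤ 0) := by
  simp [cutSet]

lemma sum_cutSet (a : ℕ → ℝ) (u v : ℕ) :
    ∑ i ∈ cutSet a u v, a i = posSum a u - negSum a v := by
  rw [cutSet, sum_union, posSum, negSum, sum_filter, sum_filter, sub_eq_add_neg,
    ← sum_neg_distrib]
  · congr 1 <;> refine sum_congr rfl fun i _ => ?_ <;> split_ifs with h
    · exact (max_eq_left h.le).symm
    · exact (max_eq_right (not_lt.1 h)).symm
    · rw [max_eq_left (by linarith), neg_neg]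
    · rw [max_eq_right (by linarith), neg_zero]
  · rw [Finset.disjoint_left]
    intro i hi hj
    simp only [mem_filter] at hi hj
    linarith

lemma posSum_mono (a : ℕ → ℝ) : Monotone (posSum a) :=
  monotone_nat_of_le_succ fun n => by simp [posSum, sum_range_succ]

lemma negSum_mono (a : ℕ → ℝ) : Monotone (negSum a) :=
  monotone_nat_of_le_succ fun n => by simp [negSum, sum_range_succ]

lemma ascents_mono (a : ℕ → ℝ) : Monotone (ascents a) := Nat.count_monotone _

lemma ascents_succ_le (a : ℕ → ℝ) (n : ℕ) : ascents a (n + 1) ≤ ascents a n + 1 := by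
  rw [ascents, Nat.count_succ]
  split_ifs <;> simp [ascents]

lemma ascents_add_eq_descents_add (a : ℕ → ℝ) (n : ℕ) :
    ascents a n + (if 0 < a 0 then 1 else 0) = descents a n + (if 0 < a n then 1 else 0) := by
  induction n with
  | zero => simp [ascents, descents]
  | succ n ih =>
    simp only [ascents, descents, Nat.count_succ, ← not_lt] at *
    split_ifs at * <;> first | omega | tauto

lemma card_filter_Ico_add_count (p : ℕ → Prop) [DecidablePred p] {u v : ℕ} (h : u ≤ v) :
    ((Ico u v).filter p).card + Nat.count p u = Nat.count p v := by
  have hv : range v = range u ∪ Ico u v := by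
    rw [range_eq_Ico, range_eq_Ico, Ico_union_Ico_eq_Ico (Nat.zero_le u) h]
  rw [Nat.count_eq_card_filter_range, Nat.count_eq_card_filter_range, hv, filter_union,
    card_union_of_disjoint, add_comm]
  rw [range_eq_Ico]
  exact disjoint_filter_filter (Ico_disjoint_Ico_consecutive 0 u v)

lemma ascents_le_add_blockCount (a : ℕ → ℝ) {u v : ℕ} (h : u ≤ v) :
    ascents a v ≤ ascents a u + blockCount (cutSet a u v) := by
  rw [ascents, ← card_filter_Ico_add_count _ h, add_comm]
  refine Nat.add_le_add_left (card_le_card fun i hi => ?_) _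
  simp only [mem_filter, mem_Ico, mem_cutSet] at *
  obtain ⟨⟨h1, h2⟩, h3, h4⟩ := hi
  refine ⟨.inr ⟨h2, h3⟩, ?_⟩
  rintro (⟨h5, -⟩ | ⟨-, h5⟩)
  · omega
  · linarith

lemma descents_le_add_blockCount (a : ℕ → ℝ) {u v : ℕ} (h : v ≤ u) :
    descents a u ≤ descents a v + blockCount (cutSet a u v) := by
  rw [descents, ← card_filter_Ico_add_count _ h, add_comm]
  refine Nat.add_le_add_left (card_le_card fun i hi => ?_) _
  simp only [mem_filter, mem_Ico, mem_cutSet] at *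
  obtain ⟨⟨h1, h2⟩, h3, h4⟩ := hi
  refine ⟨.inl ⟨h2, h3⟩, ?_⟩
  rintro (⟨-, h5⟩ | ⟨h5, -⟩)
  · linarith
  · omega

lemma card_insert_insert_le {s t : Finset ℕ} {x y : ℕ} (h : s ⊆ insert x (insert y t)) :
    s.card ≤ t.card + 2 :=
  (card_le_card h).trans <| (card_insert_le _ _).trans <|
    Nat.succ_le_succ (card_insert_le _ _)

lemma blockCount_le_of_le (a : ℕ → ℝ) {u v : ℕ} (h : u ≤ v) :
    blockCount (cutSet a u v) + ascents a u ≤ ascents a v + 2 := by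
  have key : blockCount (cutSet a u v) ≤
      ((Ico u v).filter (fun i => a i ≤ 0 ∧ 0 < a (i + 1))).card + 2 := by
    refine card_insert_insert_le (x := u - 1) (y := v - 1) fun i hi => ?_
    simp only [mem_filter, mem_insert, mem_Ico, mem_cutSet, ← not_lt] at *
    by_cases 0 < a i <;> by_cases 0 < a (i + 1) <;> simp_all <;> omega
  rw [ascents, ascents, ← card_filter_Ico_add_count _ h]
  omega

lemma blockCount_le_of_ge (a : ℕ → ℝ) {u v : ℕ} (h : v ≤ u) :
    blockCount (cutSet a u v) + descents a v ≤ descents a u + 2 := by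
  have key : blockCount (cutSet a u v) ≤
      ((Ico v u).filter (fun i => 0 < a i ∧ a (i + 1) ≤ 0)).card + 2 := by
    refine card_insert_insert_le (x := u - 1) (y := v - 1) fun i hi => ?_
    simp only [mem_filter, mem_insert, mem_Ico, mem_cutSet, ← not_lt] at *
    by_cases 0 < a i <;> by_cases 0 < a (i + 1) <;> simp_all <;> omega
  rw [descents, descents, ← card_filter_Ico_add_count _ h]
  omega

lemma ascents_dist_le (a : ℕ → ℝ) (u v : ℕ) :
    ascents a u ≤ ascents a v + (blockCount (cutSet a u v) + 1) ∧
      ascents a v ≤ ascents a u + (blockCount (cutSet a u v) + 1) := by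
  have hu := ascents_add_eq_descents_add a u
  have hv := ascents_add_eq_descents_add a v
  rcases le_total u v with h | h
  · have h1 := ascents_mono a h
    have h2 := ascents_le_add_blockCount a h
    omega
  · have h1 := ascents_mono a h
    have h2 := descents_le_add_blockCount a h
    split_ifs at * <;> omega

lemma blockCount_cutSet_le (a : ℕ → ℝ) {u v K : ℕ} (h1 : ascents a u ≤ ascents a v + K)
    (h2 : ascents a v ≤ ascents a u + K) : blockCount (cutSet a u v) ≤ K + 3 := by
  have hu := ascents_add_eq_descents_add a u
  have hv := ascents_add_eq_descents_add a v
  rcases le_total u v with h | h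
  · have h3 := blockCount_le_of_le a h
    omega
  · have h3 := blockCount_le_of_ge a h
    split_ifs at * <;> omega

lemma tendsto_ascents {a : ℕ → ℝ} (hP : {n : ℕ | 0 < a n}.Infinite)
    (hN : {n : ℕ | a n ≤ 0}.Infinite) : Tendsto (ascents a) atTop atTop := by
  refine tendsto_atTop_atTop_of_monotone (ascents_mono a) fun b => ?_
  have hinf : {i | a i ≤ 0 ∧ 0 < a (i + 1)}.Infinite := by
    refine Set.infinite_of_forall_exists_gt fun N => ?_
    obtain ⟨n, hn, hNn⟩ := hN.exists_gt N
    have hex : ∃ m, n < m ∧ 0 < a m := by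
      obtain ⟨m, hm, hnm⟩ := hP.exists_gt n
      exact ⟨m, hnm, hm⟩
    obtain ⟨h1, h2⟩ := Nat.find_spec hex
    obtain ⟨m, hm⟩ : ∃ m, Nat.find hex = m + 1 := ⟨Nat.find hex - 1, by omega⟩
    have h3 := Nat.find_min hex (m := m) (by omega)
    rw [hm] at h1 h2
    refine ⟨m, ⟨?_, h2⟩, by omega⟩
    rcases (Nat.lt_succ_iff.1 h1).eq_or_lt with h | h
    · exact h ▸ hn
    · exact not_lt.1 fun h' => h3 ⟨h, h'⟩
  exact ⟨Nat.nth _ b, (Nat.count_nth_of_infinite hinf b).ge⟩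

lemma partialSum_comp (a : ℕ → ℝ) (σ : Equiv.Perm ℕ) (n : ℕ) :
    partialSum (fun n => a (σ n)) n = ∑ i ∈ (range n).image σ, a i := by
  rw [partialSum, sum_image σ.injective.injOn]

/-- A bounded block number bounds the block count at every stage, the empty one included. -/
lemma HasBBN.blockCount_le {σ : Equiv.Perm ℕ} {C : ℕ} (h : HasBBN σ C) (n : ℕ) :
    blockCount ((range n).image σ) ≤ C := by
  cases n with
  | zero => simp [blockCount]
  | succ n => exact h n

/-- The terms of a series with a convergent rearrangement tend to zero. -/
lemma tendsto_zero_of_convergesTo {a : ℕ → ℝ} {σ : Equiv.Perm ℕ} {r : ℝ}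
    (h : ConvergesTo (fun n => a (σ n)) r) : Tendsto a atTop (nhds 0) := by
  have h1 : Tendsto (fun n => a (σ n)) atTop (nhds 0) := by
    have h2 := ((tendsto_add_atTop_iff_nat 1).2 h).sub h
    simpa [partialSum, sum_range_succ] using h2
  have h2 : Tendsto σ.symm atTop atTop := by
    rw [← Nat.cofinite_eq_atTop]
    exact σ.symm.injective.tendsto_cofinite
  simpa [Function.comp_def] using h1.comp h2

/-- When a type R permutation has just used all nonpositive terms at positions `< v`, the
set of used positions is a cut. -/
lemma exists_image_eq_cutSet {a : ℕ → ℝ} (hP : {n : ℕ | 0 < a n}.Infinite)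
    {σ : Equiv.Perm ℕ} (hσ : IsTypeR a σ) (v : ℕ) :
    ∃ n u, (range n).image σ = cutSet a u v ∧ ∀ i < v, a i ≤ 0 → σ.symm i < n := by
  have hlt : ∀ i j, i < j → ((0 < a i ∧ 0 < a j) ∨ (a i ≤ 0 ∧ a j ≤ 0)) →
      σ.symm i < σ.symm j := fun i j hij h => hσ _ _ (by simpa using hij) (by simpa using h)
  have hn : ∃ n, ∀ i < v, a i ≤ 0 → σ.symm i < n := by
    refine ⟨(range v).sup σ.symm + 1, fun i hi _ => Nat.lt_succ_of_le ?_⟩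
    exact le_sup (f := σ.symm) (mem_range.2 hi)
  have hnspec := Nat.find_spec hn
  have hnmin := fun m => Nat.find_min hn (m := m)
  generalize Nat.find hn = n at hnspec hnmin
  have hu : ∃ u, 0 < a u ∧ n ≤ σ.symm u := by
    obtain ⟨u, hu, hu'⟩ := (hP.sdiff ((range n).image σ).finite_toSet).nonempty
    refine ⟨u, hu, not_lt.1 fun h => hu' ?_⟩
    simp only [coe_image, Set.mem_image, mem_coe, mem_range]
    exact ⟨_, h, by simp⟩
  obtain ⟨hu1, hu2⟩ := Nat.find_spec hu
  have humin := fun m => Nat.find_min hu (m := m)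
  generalize Nat.find hu = u at hu1 hu2 humin
  refine ⟨n, u, ?_, hnspec⟩
  ext i
  have hmem : i ∈ (range n).image σ ↔ σ.symm i < n := by
    simp only [mem_image, mem_range]
    exact ⟨by rintro ⟨j, hj, rfl⟩; simpa using hj, fun h => ⟨_, h, by simp⟩⟩
  rw [hmem, mem_cutSet]
  rcases lt_or_ge 0 (a i) with hi | hi
  · constructor
    · intro h
      refine .inl ⟨?_, hi⟩
      by_contra! h'
      rcases h'.eq_or_lt with rfl | h'
      · omega
      · have := hlt u i h' (.inl ⟨hu1, hi⟩)
        omega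
    · rintro (⟨h, -⟩ | ⟨-, h⟩)
      · exact not_le.1 fun h' => humin i h ⟨hi, h'⟩
      · linarith
  · constructor
    · intro h
      refine .inr ⟨?_, hi⟩
      by_contra! h'
      have hm := hnmin (n - 1) (by omega)
      push Not at hm
      obtain ⟨j, hj, hj0, hj'⟩ := hm
      have := hlt j i (by omega) (.inr ⟨hj0, hi⟩)
      omega
    · rintro (⟨-, h⟩ | ⟨h, -⟩)
      · linarith
      · exact hnspec i h hi

lemma exists_cut_of_mem_ZR {a : ℕ → ℝ} (hP : {n : ℕ | 0 < a n}.Infinite)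
    (hN : {n : ℕ | a n ≤ 0}.Infinite) {r : ℝ} (hr : r ∈ ZR a) :
    ∃ K : ℕ, ∀ ε > 0, ∃ V, ∀ v ≥ V, ∃ u, ascents a u ≤ ascents a v + K ∧
      ascents a v ≤ ascents a u + K ∧ |posSum a u - negSum a v - r| < ε := by
  obtain ⟨σ, ⟨hσ, ⟨C, hC⟩, -⟩, hr⟩ := hr
  refine ⟨C + 1, fun ε hε => ?_⟩
  obtain ⟨M, hM⟩ := Metric.tendsto_atTop.1 hr ε hε
  obtain ⟨i, hi, hi'⟩ := (hN.sdiff ((range M).image σ).finite_toSet).nonempty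
  refine ⟨i + 1, fun v hv => ?_⟩
  obtain ⟨n, u, hnu, hn⟩ := exists_image_eq_cutSet hP hσ v
  have hMn : M ≤ n := by
    by_contra! h
    refine hi' ?_
    simp only [coe_image, Set.mem_image, mem_coe, mem_range]
    exact ⟨σ.symm i, (hn i (by omega) hi).trans h, by simp⟩
  have h1 := ascents_dist_le a u v
  have h2 := hC.blockCount_le n
  rw [hnu] at h2
  refine ⟨u, by omega, by omega, ?_⟩
  have h3 := hM n hMn
  rwa [partialSum_comp, hnu, sum_cutSet, Real.dist_eq] at h3

/-- An injective key on `ℕ` sorts the natural numbers. -/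
lemma exists_perm_strictMono_comp {key : ℕ → ℕ} (h : Function.Injective key) :
    ∃ σ : Equiv.Perm ℕ, StrictMono fun n => key (σ n) := by
  have : Infinite (Set.range key) := (Set.infinite_range_of_injective h).to_subtype
  let e := Nat.Subtype.orderIsoOfNat (Set.range key)
  refine ⟨e.toEquiv.trans (Equiv.ofInjective key h).symm, fun m n hmn => ?_⟩
  have h1 : ∀ n, key ((Equiv.ofInjective key h).symm (e n)) = e n :=
    fun n => Equiv.apply_ofInjective_symm h (e n)
  simpa [h1] using hmn

/-- A monotone sequence of cuts `(g v, v)` of bounded width whose sums tend to `t` is realised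
by a type R λ-permutation with sum `t`. -/
lemma mem_ZR_of_cuts {a : ℕ → ℝ} (ha : Tendsto a atTop (nhds 0)) {g : ℕ → ℕ}
    (hg : Monotone g) (hg' : Tendsto g atTop atTop) {K : ℕ} (hK : ∀ v,
      ascents a (g v) ≤ ascents a v + K ∧ ascents a v ≤ ascents a (g v) + K) {t : ℝ}
    (ht : Tendsto (fun v => posSum a (g v) - negSum a v) atTop (nhds t)) : t ∈ ZR a := by
  have hex : ∀ i, ∃ v, i < g v := fun i => (hg'.eventually_gt_atTop i).exists
  let h : ℕ → ℕ := fun i => Nat.find (hex i)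
  have hle : ∀ i w, h i ≤ w ↔ i < g w := fun i w =>
    ⟨fun hw => (Nat.find_spec (hex i)).trans_le (hg hw), fun hw => Nat.find_min' _ hw⟩
  have hmono : Monotone h := fun i j hij => (hle _ _).2 (hij.trans_lt ((hle j _).1 le_rfl))
  let key : ℕ → ℕ := fun i => if 0 < a i then i + h i else i + g i
  have keyP : ∀ {i}, 0 < a i → key i = i + h i := fun hi => if_pos hi
  have keyN : ∀ {i}, a i ≤ 0 → key i = i + g i := fun hi => if_neg (not_lt.2 hi)
  have hlt : ∀ i j, i < j → ((0 < a i ∧ 0 < a j) ∨ (a i ≤ 0 ∧ a j ≤ 0)) → key i < key j := by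
    rintro i j hij (⟨hi, hj⟩ | ⟨hi, hj⟩)
    · rw [keyP hi, keyP hj]
      have := hmono hij.le
      omega
    · rw [keyN hi, keyN hj]
      have := hg hij.le
      omega
  have hne : ∀ i j, 0 < a i → a j ≤ 0 → key i ≠ key j := by
    intro i j hi hj
    rw [keyP hi, keyN hj]
    have := hle i j
    omega
  have hinj : Function.Injective key := by
    intro i j hij
    rcases lt_or_ge 0 (a i) with hi | hi <;> rcases lt_or_ge 0 (a j) with hj | hj
    · rcases lt_trichotomy i j with h | h | h
      · exact absurd hij (hlt i j h (.inl ⟨hi, hj⟩)).ne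
      · exact h
      · exact absurd hij (hlt j i h (.inl ⟨hj, hi⟩)).ne'
    · exact absurd hij (hne i j hi hj)
    · exact absurd hij.symm (hne j i hj hi)
    · rcases lt_trichotomy i j with h | h | h
      · exact absurd hij (hlt i j h (.inr ⟨hi, hj⟩)).ne
      · exact h
      · exact absurd hij (hlt j i h (.inr ⟨hj, hi⟩)).ne'
  obtain ⟨σ, hσ⟩ := exists_perm_strictMono_comp hinj
  have hcut : ∀ n, ∃ u v, (range n).image σ = cutSet a u v ∧ n ≤ v + g v ∧ u ≤ g v ∧
      (v = 0 ∨ g (v - 1) ≤ u) := by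
    intro n
    set T := key (σ n) with hT
    have hnT : n ≤ T := hσ.le_apply
    have hvex : ∃ v, T ≤ v + g v := ⟨T, by omega⟩
    have hv := Nat.find_spec hvex
    have hvmin := fun m => Nat.find_min hvex (m := m)
    have hvT : Nat.find hvex ≤ T := Nat.find_min' _ (by omega)
    generalize Nat.find hvex = v at hv hvmin hvT
    have hv1 := hvmin (v - 1)
    refine ⟨T - v, v, ?_, by omega, by omega, by omega⟩
    ext i
    have hmem : i ∈ (range n).image σ ↔ key i < T := by
      simp only [mem_image, mem_range]
      constructor
      · rintro ⟨m, hm, rfl⟩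
        exact hσ hm
      · intro hi
        refine ⟨σ.symm i, hσ.lt_iff_lt.1 ?_, by simp⟩
        simpa using hi
    rw [hmem, mem_cutSet]
    rcases lt_or_ge 0 (a i) with hi | hi
    · rw [keyP hi]
      have h1 := hle i v
      have h2 := hle i (v - 1)
      simp only [hi, not_le.2 hi, and_true, and_false, or_false]
      omega
    · rw [keyN hi]
      simp only [hi, not_lt.2 hi, and_true, and_false, false_or]
      constructor
      · intro hlt'
        by_contra! hvi
        have := hg hvi
        omega
      · intro hiv
        have := hvmin i hiv
        omega
  choose U W hUW hnW hUg hgU using hcut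
  have hW : Tendsto W atTop atTop := by
    refine tendsto_atTop.2 fun b => ?_
    filter_upwards [eventually_gt_atTop (b + g b)] with n hn
    by_contra! hb
    have := hg hb.le
    have := hnW n
    omega
  have hconv : ConvergesTo (fun n => a (σ n)) t := by
    have hF : ∀ n, partialSum (fun n => a (σ n)) n = posSum a (U n) - negSum a (W n) :=
      fun n => by rw [partialSum_comp, hUW, sum_cutSet]
    have hW1 : Tendsto (fun n => W n - 1) atTop atTop := (tendsto_sub_atTop_nat 1).comp hW
    have hlow : Tendsto (fun n => (posSum a (g (W n - 1)) - negSum a (W n - 1)) -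
        max (-a (W n - 1)) 0) atTop (nhds t) := by
      have h1 : Tendsto (fun n => max (-a n) 0) atTop (nhds 0) := by
        simpa using (ha.neg).max (tendsto_const_nhds (x := (0 : ℝ)))
      simpa [Function.comp_def] using (ht.sub h1).comp hW1
    refine tendsto_of_tendsto_of_tendsto_of_le_of_le' hlow (ht.comp hW) ?_ ?_
    · filter_upwards [hW.eventually_gt_atTop 0] with n hn
      obtain ⟨w, hw⟩ : ∃ w, W n = w + 1 := ⟨W n - 1, by omega⟩
      have h1 := posSum_mono a ((hgU n).resolve_left (by omega))
      have h2 : negSum a (w + 1) = negSum a w + max (-a w) 0 := sum_range_succ _ _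
      rw [hF, hw, h2, Nat.add_sub_cancel]
      rw [hw, Nat.add_sub_cancel] at h1
      linarith
    · refine Eventually.of_forall fun n => ?_
      rw [hF]
      exact sub_le_sub_right (posSum_mono a (hUg n)) _
  refine ⟨σ, ⟨?_, ⟨K + 1 + (ascents a (g 0) + ascents a 0) + 3, fun n => ?_⟩, t, hconv⟩, hconv⟩
  · intro i j hij hs
    exact hσ.lt_iff_lt.1 (hlt _ _ hij hs)
  · rw [hUW]
    generalize n + 1 = m
    have h1 := ascents_mono a (hUg m)
    have h2 := hK (W m)
    apply blockCount_cutSet_le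
    · omega
    · rcases hgU m with h0 | h0
      · rw [h0]
        omega
      · have h3 := ascents_mono a h0
        have h4 := hK (W m - 1)
        have h5 := (ascents_mono a (Nat.le_succ_of_pred_le le_rfl : W m ≤ W m - 1 + 1)).trans
          (ascents_succ_le a (W m - 1))
        omega

/-- Two distinct attainable sums force the positive terms to be substantial. -/
lemma exists_posSum_add_le {a : ℕ → ℝ} (hP : {n : ℕ | 0 < a n}.Infinite)
    (hN : {n : ℕ | a n ≤ 0}.Infinite) {r s : ℝ} (hr : r ∈ ZR a) (hs : s ∈ ZR a) (hrs : r < s) :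
    ∃ M : ℕ, ∃ ε > 0, ∀ x y, ascents a x + M ≤ ascents a y → posSum a x + ε ≤ posSum a y := by
  obtain ⟨K, hK⟩ := exists_cut_of_mem_ZR hP hN hr
  obtain ⟨L, hL⟩ := exists_cut_of_mem_ZR hP hN hs
  have hε : 0 < (s - r) / 4 := by linarith
  obtain ⟨V, hV⟩ := hK _ hε
  obtain ⟨V', hV'⟩ := hL _ hε
  have key : ∀ x y, V ≤ x → V' ≤ x → ascents a x + (K + L + 2) ≤ ascents a y →
      posSum a x + (s - r) / 4 ≤ posSum a y := by
    intro x y hx hx' hxy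
    have hex : ∃ v, ascents a x + K + 1 ≤ ascents a v := ⟨y, by omega⟩
    have hv := Nat.find_spec hex
    have hvmin := fun m => Nat.find_min hex (m := m)
    generalize Nat.find hex = v at hv hvmin
    have hxv : x < v := (ascents_mono a).reflect_lt (by omega)
    have h1 := hvmin (v - 1) (by omega)
    have h2 := ascents_succ_le a (v - 1)
    rw [Nat.sub_add_cancel (by omega)] at h2
    obtain ⟨p, hp1, hp2, hp3⟩ := hV v (by omega)
    obtain ⟨q, hq1, hq2, hq3⟩ := hV' v (by omega)
    have hxp := posSum_mono a ((ascents_mono a).reflect_lt (a := x) (b := p) (by omega)).le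
    have hqy := posSum_mono a ((ascents_mono a).reflect_lt (a := q) (b := y) (by omega)).le
    rw [abs_lt] at hp3 hq3
    linarith
  refine ⟨K + L + 2 + ascents a (max V V'), _, hε, fun x y hxy => ?_⟩
  have h1 := key (max x (max V V')) y (by simp) (by simp) (by
    rcases max_cases x (max V V') with ⟨h, -⟩ | ⟨h, -⟩ <;> rw [h] <;> omega)
  exact (add_le_add_left (posSum_mono a (le_max_left _ _)) _).trans h1

lemma exists_ascents_eq {a : ℕ → ℝ} (ha : Tendsto (ascents a) atTop atTop) (n : ℕ) :
    ∃ z, ascents a z = n := by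
  have hex : ∃ z, n ≤ ascents a z := (ha.eventually_ge_atTop n).exists
  refine ⟨Nat.find hex, le_antisymm ?_ (Nat.find_spec hex)⟩
  rcases Nat.eq_zero_or_pos (Nat.find hex) with h | h
  · rw [h]
    simp [ascents]
  · have h1 := Nat.find_min hex (Nat.sub_lt h one_pos)
    have h2 := ascents_succ_le a (Nat.find hex - 1)
    rw [Nat.sub_add_cancel h] at h2
    omega

lemma posSum_add_mul_le {a : ℕ → ℝ} {M : ℕ} {ε : ℝ} (ha : Tendsto (ascents a) atTop atTop)
    (h : ∀ x y, ascents a x + M ≤ ascents a y → posSum a x + ε ≤ posSum a y) (m x y : ℕ)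
    (hxy : ascents a x + m * M < ascents a y) : posSum a x + m * ε ≤ posSum a y := by
  induction m generalizing x with
  | zero =>
    simp only [zero_mul, add_zero, Nat.cast_zero] at *
    exact posSum_mono a ((ascents_mono a).reflect_lt hxy).le
  | succ m ih =>
    obtain ⟨z, hz⟩ := exists_ascents_eq ha (ascents a x + M)
    have h1 := h x z hz.ge
    have h2 := ih z (by rw [hz]; linarith)
    push_cast
    linarith

/-- If some sum is attainable and the positive terms are substantial, every real number is
an attainable sum. -/
lemma mem_ZR_of_posSum_add_le {a : ℕ → ℝ} (hP : {n : ℕ | 0 < a n}.Infinite)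
    (hN : {n : ℕ | a n ≤ 0}.Infinite) {r : ℝ} (hr : r ∈ ZR a) {M : ℕ} {ε : ℝ} (hε : 0 < ε)
    (h : ∀ x y, ascents a x + M ≤ ascents a y → posSum a x + ε ≤ posSum a y) (t : ℝ) :
    t ∈ ZR a := by
  have hasc := tendsto_ascents hP hN
  have ha : Tendsto a atTop (nhds 0) := by
    obtain ⟨σ, -, hσ⟩ := hr
    exact tendsto_zero_of_convergesTo hσ
  have hmul := posSum_add_mul_le hasc h
  have hpos0 : posSum a 0 = 0 := by simp [posSum]
  have hasc0 : ascents a 0 = 0 := by simp [ascents]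
  have hunb : ∀ b, ∃ x, b ≤ posSum a x := by
    intro b
    obtain ⟨m, hm⟩ := exists_nat_ge (b / ε)
    obtain ⟨y, hy⟩ := (hasc.eventually_gt_atTop (m * M)).exists
    have h1 := hmul m 0 y (by omega)
    rw [div_le_iff₀ hε] at hm
    exact ⟨y, by linarith⟩
  obtain ⟨K, hK⟩ := exists_cut_of_mem_ZR hP hN hr
  obtain ⟨V, hV⟩ := hK 1 one_pos
  let g : ℕ → ℕ := fun v => Nat.find (hunb (negSum a v + t))
  have hg1 : ∀ v, negSum a v + t ≤ posSum a (g v) := fun v => Nat.find_spec (hunb _)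
  have hg2 : ∀ v, 0 < g v → posSum a (g v - 1) < negSum a v + t := fun v hv =>
    not_le.1 (Nat.find_min (hunb (negSum a v + t)) (Nat.sub_lt hv one_pos))
  have hg : Monotone g := fun v w hvw =>
    Nat.find_min' _ ((add_le_add_left (negSum_mono a hvw) t).trans (hg1 w))
  obtain ⟨m, hm⟩ := exists_nat_ge ((|t - r| + 2) / ε)
  rw [div_le_iff₀ hε] at hm
  have habs := abs_le.1 (le_refl |t - r|)
  have hlarge : ∀ v ≥ V, ascents a (g v) ≤ ascents a v + (K + m * M + 1) ∧
      ascents a v ≤ ascents a (g v) + (K + m * M + 1) := by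
    intro v hv
    obtain ⟨u, hu1, hu2, hu3⟩ := hV v hv
    rw [abs_lt] at hu3
    have h1 : ascents a (g v) ≤ ascents a u + m * M + 1 := by
      rcases Nat.eq_zero_or_pos (g v) with h0 | h0
      · rw [h0]
        omega
      · by_contra! hlt
        have h2 := ascents_succ_le a (g v - 1)
        rw [Nat.sub_add_cancel h0] at h2
        have h3 := hmul m u (g v - 1) (by omega)
        have h4 := hg2 v h0
        linarith
    have h2 : ascents a u ≤ ascents a (g v) + m * M := by
      by_contra! hlt
      have h3 := hmul m (g v) u hlt
      have h4 := hg1 v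
      linarith
    omega
  have hdist : ∀ v,
      ascents a (g v) ≤ ascents a v + (K + m * M + 1 + ascents a (g V) + ascents a V) ∧
      ascents a v ≤ ascents a (g v) + (K + m * M + 1 + ascents a (g V) + ascents a V) := by
    intro v
    rcases le_total V v with hv | hv
    · have := hlarge v hv
      omega
    · have h1 := ascents_mono a hv
      have h2 := ascents_mono a (hg hv)
      omega
  have hg' : Tendsto g atTop atTop := by
    refine tendsto_atTop.2 fun b => ?_
    filter_upwards [hasc.eventually_gt_atTop
      (ascents a b + (K + m * M + 1 + ascents a (g V) + ascents a V))] with v hv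
    have := hdist v
    exact ((ascents_mono a).reflect_lt (by omega)).le
  refine mem_ZR_of_cuts ha hg hg' hdist ?_
  have hmax : Tendsto (fun n => t + max (a (n - 1)) 0) atTop (nhds t) := by
    have h1 := (ha.comp (tendsto_sub_atTop_nat 1)).max (tendsto_const_nhds (x := (0 : ℝ)))
    simpa [Function.comp_def] using h1.const_add t
  refine tendsto_of_tendsto_of_tendsto_of_le_of_le' tendsto_const_nhds (hmax.comp hg') ?_ ?_
  · exact Eventually.of_forall fun v => by linarith [hg1 v]
  · filter_upwards [hg'.eventually_gt_atTop 0] with v hv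
    have h1 := hg2 v hv
    have h2 : posSum a (g v - 1 + 1) = posSum a (g v - 1) + max (a (g v - 1)) 0 :=
      sum_range_succ _ _
    rw [Nat.sub_add_cancel hv] at h2
    simp only [Function.comp_apply]
    linarith

/-- For a conditionally divergent series with `a 0 ≤ 0` having
infinitely many positive and infinitely many nonpositive terms, the set `Z_R`
of sums attainable by type R λ-permutations is empty, a singleton, or all of `ℝ`. -/
theorem statement0 (a : ℕ → ℝ) (h0 : a 0 ≤ 0)
    (hP : {n : ℕ | 0 < a n}.Infinite) (hN : {n : ℕ | a n ≤ 0}.Infinite)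
    (hcd : CondDivergent a) :
    ZR a = ∅ ∨ (∃ r : ℝ, ZR a = {r}) ∨ ZR a = Set.univ := by
  rcases (ZR a).eq_empty_or_nonempty with h | ⟨r, hr⟩
  · exact .inl h
  by_cases hsub : (ZR a).Subsingleton
  · exact .inr (.inl ⟨r, hsub.eq_singleton_of_mem hr⟩)
  refine .inr (.inr (Set.eq_univ_of_forall fun t => ?_))
  obtain ⟨x, hx, y, hy, hxy⟩ := (Set.not_subsingleton_iff.1 hsub).exists_lt
  obtain ⟨M, ε, hε, h⟩ := exists_posSum_add_le hP hN hx hy hxy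
  exact mem_ZR_of_posSum_add_le hP hN hr hε h t
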